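/- Let σ* be a vector of singular values of a critical point with σ*_max its largest entry, and let L_G = λL + 2^{2L−1}L²(σ*_max)^{2L−2} + √λ·y₁·2^{L−2}L²(σ*_max)^{L−2}. Then for all W with dist(W, 𝒲_{σ*}) ≤ σ*_max, one has ‖∇G(W)‖_F ≤ L_G · dist(W, 𝒲_{σ*}). -/

import Mathlib

open Matrix

/-- Frobenius norm of a real matrix. -/
noncomputable def frob {m n : Type*} [Fintype m] [Fintype n] (A : Matrix m n ℝ) : ℝ :=
  Real.sqrt (∑ i, ∑ j, (A i j) ^ 2)

/-- Spectral (operator ℓ²→ℓ²) norm of a real matrix. -/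
noncomputable def spec {m n : Type*} [Fintype m] [Fintype n] [DecidableEq n] (A : Matrix m n ℝ) : ℝ :=
  ‖LinearMap.toContinuousLinearMap (Matrix.toEuclideanLin A)‖

/-- Reindexing cast of a rectangular matrix along equalities of dimensions. -/
def mcast {a b c e : ℕ} (h1 : a = c) (h2 : b = e) (M : Matrix (Fin a) (Fin b) ℝ) :
    Matrix (Fin c) (Fin e) ℝ :=
  Matrix.submatrix M (Fin.cast h1.symm) (Fin.cast h2.symm)

/-- `chain d W i k = W_{i+k-1} * ⋯ * W_{i+1} * W_i` (so `k` consecutive factors starting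
at layer `i`; the empty product is the identity). -/
noncomputable def chain (d : ℕ → ℕ) (W : ∀ l : ℕ, Matrix (Fin (d (l + 1))) (Fin (d l)) ℝ)
    (i : ℕ) : (k : ℕ) → Matrix (Fin (d (i + k))) (Fin (d i)) ℝ
  | 0 => (1 : Matrix (Fin (d i)) (Fin (d i)) ℝ)
  | k + 1 => W (i + k) * chain d W i k

/-- The gradient with respect to the `j`-th weight (0-based) of the loss
`‖W_{L:1} − c·Y‖_F² + ∑_l reg_l ‖W_l‖_F²`, namely
`2·W_{L:j+2}ᵀ (W_{L:1} − c Y) W_{j:1}ᵀ + 2 reg_j W_j`. -/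
noncomputable def gradReg (d : ℕ → ℕ) (L : ℕ)
    (W : ∀ l : ℕ, Matrix (Fin (d (l + 1))) (Fin (d l)) ℝ)
    (reg : ℕ → ℝ) (c : ℝ) (Y : Matrix (Fin (d L)) (Fin (d 0)) ℝ)
    (j : ℕ) (hj : j < L) : Matrix (Fin (d (j + 1))) (Fin (d j)) ℝ :=
  (2 : ℝ) • ((mcast (congrArg d (by omega : j + 1 + (L - 1 - j) = L)) rfl
      (chain d W (j + 1) (L - 1 - j)))ᵀ *
    (mcast (congrArg d (Nat.zero_add L)) rfl (chain d W 0 L) - c • Y) *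
    (mcast (congrArg d (Nat.zero_add j)) rfl (chain d W 0 j))ᵀ) + (2 * reg j) • W j

/-- Frobenius norm of the full gradient of the loss above. -/
noncomputable def gradNorm (d : ℕ → ℕ) (L : ℕ)
    (W : ∀ l : ℕ, Matrix (Fin (d (l + 1))) (Fin (d l)) ℝ)
    (reg : ℕ → ℝ) (c : ℝ) (Y : Matrix (Fin (d L)) (Fin (d 0)) ℝ) : ℝ :=
  Real.sqrt (∑ j : Fin L, (frob (gradReg d L W reg c Y j j.isLt)) ^ 2)

/-- Euclidean (Frobenius) distance from a tuple of weight matrices to a set of such tuples,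
measured over the first `L` layers. -/
noncomputable def tdist (d : ℕ → ℕ) (L : ℕ)
    (W : ∀ l : ℕ, Matrix (Fin (d (l + 1))) (Fin (d l)) ℝ)
    (S : Set (∀ l : ℕ, Matrix (Fin (d (l + 1))) (Fin (d l)) ℝ)) : ℝ :=
  sInf {r : ℝ | ∃ V ∈ S, r = Real.sqrt (∑ j : Fin L, (frob (W j - V j)) ^ 2)}


lemma le_of_sq_aux {a b : ℝ} (h : a ^ 2 ≤ b ^ 2) (hb : 0 ≤ b) : a ≤ b :=
  (le_abs_self a).trans (abs_le_of_sq_le_sq h hb)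

section helpers
variable {m n p : Type*} [Fintype m] [Fintype n] [Fintype p] [DecidableEq m] [DecidableEq n] [DecidableEq p]

lemma frob_nonneg (A : Matrix m n ℝ) : 0 ≤ frob A := Real.sqrt_nonneg _

lemma frob_sq (A : Matrix m n ℝ) : frob A ^ 2 = ∑ i, ∑ j, (A i j) ^ 2 :=
  Real.sq_sqrt (Finset.sum_nonneg fun _ _ => Finset.sum_nonneg fun _ _ => sq_nonneg _)

lemma frob_eq (A : Matrix m n ℝ) :
    frob A = ‖(WithLp.toLp 2 (fun q : m × n => A q.1 q.2) : EuclideanSpace ℝ (m × n))‖ := by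
  rw [EuclideanSpace.norm_eq, frob, Fintype.sum_prod_type]
  simp

lemma frob_add (A B : Matrix m n ℝ) : frob (A + B) ≤ frob A + frob B := by
  rw [frob_eq, frob_eq A, frob_eq B]
  exact norm_add_le (WithLp.toLp 2 (fun q : m × n => A q.1 q.2) : EuclideanSpace ℝ (m × n))
    (WithLp.toLp 2 (fun q : m × n => B q.1 q.2))

lemma frob_smul (c : ℝ) (A : Matrix m n ℝ) : frob (c • A) = |c| * frob A := by
  rw [frob_eq, frob_eq A, ← Real.norm_eq_abs, ← norm_smul]
  rfl

lemma frob_transpose (A : Matrix m n ℝ) : frob Aᵀ = frob A := by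
  unfold frob
  rw [Finset.sum_comm]
  rfl

lemma spec_nonneg (A : Matrix m n ℝ) : 0 ≤ spec A := norm_nonneg _

open scoped Matrix.Norms.L2Operator in
lemma spec_eq (A : Matrix m n ℝ) : spec A = ‖A‖ := by
  rw [Matrix.l2_opNorm_def]; rfl

open scoped Matrix.Norms.L2Operator in
lemma spec_transpose (A : Matrix m n ℝ) : spec Aᵀ = spec A := by
  rw [spec_eq, spec_eq, ← Matrix.l2_opNorm_conjTranspose A, Matrix.conjTranspose_eq_transpose_of_trivial]

open scoped Matrix.Norms.L2Operator in
lemma spec_mul (A : Matrix m n ℝ) (B : Matrix n p ℝ) : spec (A * B) ≤ spec A * spec B := by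
  rw [spec_eq, spec_eq, spec_eq]; exact Matrix.l2_opNorm_mul A B

open scoped Matrix.Norms.L2Operator in
lemma spec_add (A B : Matrix m n ℝ) : spec (A + B) ≤ spec A + spec B := by
  rw [spec_eq, spec_eq, spec_eq]; exact norm_add_le A B

open scoped Matrix.Norms.L2Operator in
lemma spec_smul (c : ℝ) (A : Matrix m n ℝ) : spec (c • A) = |c| * spec A := by
  rw [spec_eq, spec_eq, norm_smul, Real.norm_eq_abs]

lemma spec_one : spec (1 : Matrix n n ℝ) ≤ 1 := by
  unfold spec
  refine ContinuousLinearMap.opNorm_le_bound _ zero_le_one fun x => ?_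
  simp

lemma sum_mulVec_sq (A : Matrix m n ℝ) (x : n → ℝ) :
    ∑ i, ((A *ᵥ x) i) ^ 2 ≤ spec A ^ 2 * ∑ j, x j ^ 2 := by
  have h := (LinearMap.toContinuousLinearMap (Matrix.toEuclideanLin A)).le_opNorm (WithLp.toLp 2 x)
  have h2 := pow_le_pow_left₀ (norm_nonneg _) h 2
  rw [mul_pow, EuclideanSpace.norm_sq_eq, EuclideanSpace.norm_sq_eq] at h2
  simpa [spec] using h2

lemma frob_mul_left (A : Matrix m n ℝ) (B : Matrix n p ℝ) : frob (A * B) ≤ spec A * frob B := by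
  refine le_of_sq_aux ?_ (mul_nonneg (spec_nonneg _) (frob_nonneg _))
  rw [mul_pow, frob_sq, frob_sq, Finset.sum_comm, Finset.sum_comm (s := Finset.univ (α := n)), Finset.mul_sum]
  exact Finset.sum_le_sum fun j _ => sum_mulVec_sq A (fun k => B k j)

lemma frob_mul_right (A : Matrix m n ℝ) (B : Matrix n p ℝ) : frob (A * B) ≤ frob A * spec B := by
  rw [← frob_transpose (A * B), Matrix.transpose_mul, ← spec_transpose B, ← frob_transpose A, mul_comm (frob _)]
  exact frob_mul_left _ _

lemma spec_le_frob (A : Matrix m n ℝ) : spec A ≤ frob A := by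
  unfold spec
  refine ContinuousLinearMap.opNorm_le_bound _ (frob_nonneg _) fun x => ?_
  refine le_of_sq_aux ?_ (mul_nonneg (frob_nonneg _) (norm_nonneg _))
  rw [mul_pow, EuclideanSpace.norm_sq_eq, EuclideanSpace.norm_sq_eq, frob_sq, Finset.sum_mul]
  refine Finset.sum_le_sum fun i _ => ?_
  have := Finset.sum_mul_sq_le_sq_mul_sq Finset.univ (fun j => A i j) (fun j => x j)
  simpa [Matrix.mulVec, dotProduct] using this

lemma frob_triple {q : Type*} [Fintype q] [DecidableEq q]
    (A A' : Matrix m n ℝ) (X X' : Matrix n p ℝ) (B B' : Matrix p q ℝ) :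
    frob (A' * X' * B' - A * X * B) ≤ frob (A' - A) * spec X' * spec B'
      + spec A * frob (X' - X) * spec B' + spec A * spec X * frob (B' - B) := by
  have e : A' * X' * B' - A * X * B = (A' - A) * X' * B' + A * (X' - X) * B' + A * X * (B' - B) := by
    simp only [Matrix.sub_mul, Matrix.mul_sub]; abel
  rw [e]
  refine (frob_add _ _).trans (add_le_add ((frob_add _ _).trans (add_le_add ?_ ?_)) ?_)
  · exact (frob_mul_right _ _).trans
      (mul_le_mul_of_nonneg_right (frob_mul_right _ _) (spec_nonneg _))
  · exact (frob_mul_right _ _).trans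
      (mul_le_mul_of_nonneg_right (frob_mul_left _ _) (spec_nonneg _))
  · exact (frob_mul_left _ _).trans
      (mul_le_mul_of_nonneg_right (spec_mul _ _) (frob_nonneg _))

end helpers

lemma spec_mcast {a b c e : ℕ} (h1 : a = c) (h2 : b = e) (M : Matrix (Fin a) (Fin b) ℝ) :
    spec (mcast h1 h2 M) = spec M := by subst h1; subst h2; rfl

lemma frob_mcast_sub {a b c e : ℕ} (h1 : a = c) (h2 : b = e) (M N : Matrix (Fin a) (Fin b) ℝ) :
    frob (mcast h1 h2 M - mcast h1 h2 N) = frob (M - N) := by subst h1; subst h2; rfl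

lemma chain_spec (d : ℕ → ℕ) (W : ∀ l : ℕ, Matrix (Fin (d (l + 1))) (Fin (d l)) ℝ)
    (s : ℝ) (hs : 0 < s) (i k : ℕ) (h : ∀ l < i + k, spec (W l) ≤ s) :
    spec (chain d W i k) ≤ s ^ k := by
  induction k with
  | zero => simpa [chain] using spec_one
  | succ k ih =>
    rw [chain, pow_succ']
    exact (spec_mul _ _).trans (mul_le_mul (h _ (by omega)) (ih fun l hl => h l (by omega))
      (spec_nonneg _) hs.le)

lemma chain_diff (d : ℕ → ℕ) (W V : ∀ l : ℕ, Matrix (Fin (d (l + 1))) (Fin (d l)) ℝ)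
    (s : ℝ) (hs : 0 < s) (i k : ℕ) (h : ∀ l < i + k, spec (W l) ≤ s)
    (h' : ∀ l < i + k, spec (V l) ≤ s) :
    frob (chain d W i k - chain d V i k)
      ≤ s ^ k / s * ∑ l ∈ Finset.range k, frob (W (i + l) - V (i + l)) := by
  induction k with
  | zero => simp [chain, frob]
  | succ k ih =>
    have e : chain d W i (k+1) - chain d V i (k+1) =
      (W (i + k) - V (i + k)) * chain d W i k + V (i + k) * (chain d W i k - chain d V i k) := by
      rw [chain, chain, Matrix.sub_mul, Matrix.mul_sub]; abel
    rw [e, Finset.sum_range_succ]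
    have ih := ih (fun l hl => h l (by omega)) (fun l hl => h' l (by omega))
    have h1 := (frob_mul_right (W (i + k) - V (i + k)) (chain d W i k)).trans
      (mul_le_mul_of_nonneg_left (chain_spec d W s hs i k fun l hl => h l (by omega)) (frob_nonneg _))
    have h2 := (frob_mul_left (V (i + k)) (chain d W i k - chain d V i k)).trans
      (mul_le_mul (h' _ (by omega)) ih (frob_nonneg _) hs.le)
    refine (frob_add _ _).trans ((add_le_add h1 h2).trans (le_of_eq ?_))
    field_simp
    ring

lemma grad_diff (d : ℕ → ℕ) (L : ℕ) (hL : 2 ≤ L) (W V : ∀ l : ℕ, Matrix (Fin (d (l + 1))) (Fin (d l)) ℝ)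
    (lam c : ℝ) (hlam : 0 < lam) (hc : 0 ≤ c) (Y : Matrix (Fin (d L)) (Fin (d 0)) ℝ)
    (s : ℝ) (hs : 0 < s) (h : ∀ l < L, spec (W l) ≤ s) (h' : ∀ l < L, spec (V l) ≤ s)
    (j : ℕ) (hj : j < L) :
    frob (gradReg d L W (fun _ => lam) c Y j hj - gradReg d L V (fun _ => lam) c Y j hj)
      ≤ (4 * s ^ (2 * L - 2) + 2 * (c * spec Y) * s ^ (L - 2)) *
          (∑ l ∈ Finset.range L, frob (W l - V l)) + 2 * lam * frob (W j - V j) := by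
  have hB := chain_diff d W V s hs 0 j (fun l hl => h l (by omega)) (fun l hl => h' l (by omega))
  have hP := chain_diff d W V s hs 0 L (fun l hl => h l (by omega)) (fun l hl => h' l (by omega))
  have hA := chain_diff d W V s hs (j+1) (L-1-j) (fun l hl => h l (by omega)) (fun l hl => h' l (by omega))
  have sB := chain_spec d W s hs 0 j (fun l hl => h l (by omega))
  have sP := chain_spec d V s hs 0 L (fun l hl => h' l (by omega))
  have sPW := chain_spec d W s hs 0 L (fun l hl => h l (by omega))
  have sA := chain_spec d V s hs (j+1) (L-1-j) (fun l hl => h' l (by omega))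
  have hz : ∀ l, frob (W (0 + l) - V (0 + l)) = frob (W l - V l) := fun l => by rw [Nat.zero_add]
  simp only [hz] at hB hP
  have hT : (∑ l ∈ Finset.range j, frob (W l - V l)) +
      (∑ l ∈ Finset.range (L-1-j), frob (W (j+1+l) - V (j+1+l)))
      ≤ ∑ l ∈ Finset.range L, frob (W l - V l) := by
    have e : L = (j + 1) + (L - 1 - j) := by omega
    have e2 := Finset.sum_range_add (fun l => frob (W l - V l)) (j+1) (L-1-j)
    rw [← e, Finset.sum_range_succ] at e2
    rw [e2]
    linarith [frob_nonneg (W j - V j)]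
  set T := ∑ l ∈ Finset.range L, frob (W l - V l)
  set Ta := ∑ l ∈ Finset.range (L-1-j), frob (W (j+1+l) - V (j+1+l))
  set Tb := ∑ l ∈ Finset.range j, frob (W l - V l)
  have hTa : 0 ≤ Ta := Finset.sum_nonneg fun _ _ => frob_nonneg _
  have hTb : 0 ≤ Tb := Finset.sum_nonneg fun _ _ => frob_nonneg _
  have hT0 : 0 ≤ T := Finset.sum_nonneg fun _ _ => frob_nonneg _
  unfold gradReg
  set AW := mcast (congrArg d (by omega : j + 1 + (L - 1 - j) = L)) rfl (chain d W (j + 1) (L - 1 - j)) with hAW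
  set AV := mcast (congrArg d (by omega : j + 1 + (L - 1 - j) = L)) rfl (chain d V (j + 1) (L - 1 - j)) with hAV
  set PW := mcast (congrArg d (Nat.zero_add L)) rfl (chain d W 0 L) with hPW
  set PV := mcast (congrArg d (Nat.zero_add L)) rfl (chain d V 0 L) with hPV
  set BW := mcast (congrArg d (Nat.zero_add j)) rfl (chain d W 0 j) with hBW
  set BV := mcast (congrArg d (Nat.zero_add j)) rfl (chain d V 0 j) with hBV
  have tri := frob_triple AVᵀ AWᵀ (PV - c • Y) (PW - c • Y) BVᵀ BWᵀ
  have specX : ∀ P : Matrix (Fin (d L)) (Fin (d 0)) ℝ, spec P ≤ s ^ L →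
      spec (P - c • Y) ≤ s ^ L + c * spec Y := by
    intro P hP
    have : P - c • Y = P + (-c) • Y := by rw [neg_smul, sub_eq_add_neg]
    rw [this]
    refine (spec_add _ _).trans (add_le_add hP ?_)
    rw [spec_smul, abs_neg, abs_of_nonneg hc]
  have x1 := specX PW (by rw [hPW, spec_mcast]; exact sPW)
  have x2 := specX PV (by rw [hPV, spec_mcast]; exact sP)
  have x3 : frob (PW - c • Y - (PV - c • Y)) ≤ s ^ L / s * T := by
    rw [sub_sub_sub_cancel_right, hPW, hPV, frob_mcast_sub]; exact hP
  have x4 : spec AVᵀ ≤ s ^ (L-1-j) := by rw [spec_transpose, hAV, spec_mcast]; exact sA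
  have x5 : spec BWᵀ ≤ s ^ j := by rw [spec_transpose, hBW, spec_mcast]; exact sB
  have x6 : frob (AWᵀ - AVᵀ) ≤ s ^ (L-1-j) / s * Ta := by
    rw [← Matrix.transpose_sub, frob_transpose, hAW, hAV, frob_mcast_sub]; exact hA
  have x7 : frob (BWᵀ - BVᵀ) ≤ s ^ j / s * Tb := by
    rw [← Matrix.transpose_sub, frob_transpose, hBW, hBV, frob_mcast_sub]; exact hB
  have hy := mul_nonneg hc (spec_nonneg Y)
  set y := c * spec Y
  have tri2 : frob (AWᵀ * (PW - c • Y) * BWᵀ - AVᵀ * (PV - c • Y) * BVᵀ)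
      ≤ (s ^ (L-1-j) / s * Ta) * (s ^ L + y) * s ^ j
      + s ^ (L-1-j) * (s ^ L / s * T) * s ^ j + s ^ (L-1-j) * (s ^ L + y) * (s ^ j / s * Tb) := by
    refine tri.trans ?_
    gcongr <;> first | apply frob_nonneg | apply spec_nonneg | positivity
  have e1 : s ^ (2 * L - 2) = s ^ (L-1-j) * s ^ j * s ^ L / s := by
    rw [eq_div_iff hs.ne', ← pow_succ, ← pow_add, ← pow_add]; congr 1; omega
  have e2 : s ^ (L - 2) = s ^ (L-1-j) * s ^ j / s := by
    rw [eq_div_iff hs.ne', ← pow_succ, ← pow_add]; congr 1; omega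
  have tri3 : frob (AWᵀ * (PW - c • Y) * BWᵀ - AVᵀ * (PV - c • Y) * BVᵀ)
      ≤ (2 * s ^ (2 * L - 2) + y * s ^ (L - 2)) * T := by
    refine tri2.trans ?_
    have : (s ^ (L-1-j) / s * Ta) * (s ^ L + y) * s ^ j
      + s ^ (L-1-j) * (s ^ L / s * T) * s ^ j + s ^ (L-1-j) * (s ^ L + y) * (s ^ j / s * Tb)
      = (s ^ (2 * L - 2) + y * s ^ (L - 2)) * (Tb + Ta) + s ^ (2 * L - 2) * T := by
      rw [e1, e2]; ring
    rw [this]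
    have : (s ^ (2 * L - 2) + y * s ^ (L - 2)) * (Tb + Ta) ≤ (s ^ (2 * L - 2) + y * s ^ (L - 2)) * T :=
      mul_le_mul_of_nonneg_left hT (by positivity)
    linarith
  have e : ∀ (a b : Matrix (Fin (d (j+1))) (Fin (d j)) ℝ), (2:ℝ) • a + (2 * lam) • W j - ((2:ℝ) • b + (2 * lam) • V j)
      = (2:ℝ) • (a - b) + (2 * lam) • (W j - V j) := by
    intro a b; rw [smul_sub, smul_sub]; abel
  rw [e]
  refine (frob_add _ _).trans ?_
  rw [frob_smul, frob_smul, abs_of_pos (by positivity : (0:ℝ) < 2), abs_of_pos (by positivity : 0 < 2 * lam)]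
  linarith

lemma grad_near (L : ℕ) (hL : 2 ≤ L) (d : ℕ → ℕ) (lam : ℝ) (hlam : 0 < lam)
    (Y : Matrix (Fin (d L)) (Fin (d 0)) ℝ) (σmax : ℝ) (hσ : 0 < σmax)
    (W V : ∀ l : ℕ, Matrix (Fin (d (l + 1))) (Fin (d l)) ℝ)
    (hcrit : ∀ (j : ℕ) (hj : j < L),
      gradReg d L V (fun _ => lam) (Real.sqrt lam) Y j hj = 0)
    (hbd : ∀ l < L, spec (V l) ≤ σmax) (D : ℝ)
    (hD : Real.sqrt (∑ j : Fin L, (frob (W j - V j)) ^ 2) ≤ D) :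
    gradNorm d L W (fun _ => lam) (Real.sqrt lam) Y ≤
      ((4 * (σmax + D) ^ (2 * L - 2) + 2 * (Real.sqrt lam * spec Y) * (σmax + D) ^ (L - 2)) * L
        + 2 * lam) * D := by
  have hD0 : 0 ≤ D := (Real.sqrt_nonneg _).trans hD
  have hs : 0 < σmax + D := by positivity
  have hD2 := (Real.sqrt_le_left hD0).1 hD
  have hδ : ∀ l < L, frob (W l - V l) ≤ D := by
    intro l hl
    refine le_of_sq_aux (le_trans ?_ hD2) hD0
    exact Finset.single_le_sum (f := fun j : Fin L => frob (W j - V j) ^ 2)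
      (fun _ _ => sq_nonneg _) (Finset.mem_univ ⟨l, hl⟩)
  have hW : ∀ l < L, spec (W l) ≤ σmax + D := by
    intro l hl
    have := spec_add (V l) (W l - V l)
    rw [add_sub_cancel] at this
    linarith [hbd l hl, spec_le_frob (W l - V l), hδ l hl]
  have key := grad_diff d L hL W V lam (Real.sqrt lam) hlam (Real.sqrt_nonneg _) Y (σmax + D) hs hW
    (fun l hl => (hbd l hl).trans (by linarith))
  have hy := mul_nonneg (Real.sqrt_nonneg lam) (spec_nonneg Y)
  set K := 4 * (σmax + D) ^ (2 * L - 2) + 2 * (Real.sqrt lam * spec Y) * (σmax + D) ^ (L - 2) with hK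
  have hK0 : 0 ≤ K := by positivity
  rw [Finset.sum_range] at key
  set T := ∑ l : Fin L, frob (W l - V l) with hT
  have hT2 : T ^ 2 ≤ L * D ^ 2 := by
    have := sq_sum_le_card_mul_sum_sq (s := Finset.univ) (f := fun l : Fin L => frob (W l - V l))
    simp only [Finset.card_univ, Fintype.card_fin] at this
    exact this.trans (mul_le_mul_of_nonneg_left hD2 (by positivity))
  have hb : 0 ≤ (K * L + 2 * lam) * D := by positivity
  unfold gradNorm
  rw [Real.sqrt_le_left hb]
  calc ∑ j : Fin L, (frob (gradReg d L W (fun _ => lam) (Real.sqrt lam) Y j j.isLt)) ^ 2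
      ≤ ∑ j : Fin L, (K * T + 2 * lam * frob (W j - V j)) ^ 2 := by
        refine Finset.sum_le_sum fun j _ => pow_le_pow_left₀ (frob_nonneg _) ?_ 2
        have := key j j.isLt
        rwa [hcrit, sub_zero] at this
    _ = L * K ^ 2 * T ^ 2 + 4 * lam * K * T ^ 2 + 4 * lam ^ 2 * ∑ j : Fin L, frob (W j - V j) ^ 2 := by
        have : ∀ j : Fin L, (K * T + 2 * lam * frob (W j - V j)) ^ 2 =
          K ^ 2 * T ^ 2 + 4 * lam * K * T * frob (W j - V j) + 4 * lam ^ 2 * frob (W j - V j) ^ 2 := by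
          intro j; ring
        simp only [this, Finset.sum_add_distrib, ← Finset.mul_sum, ← hT]
        simp
        ring
    _ ≤ L * K ^ 2 * (L * D ^ 2) + 4 * lam * K * (L * D ^ 2) + 4 * lam ^ 2 * D ^ 2 := by gcongr
    _ = ((K * L + 2 * lam) * D) ^ 2 := by ring

/-- on a component `S` of the critical set of
`G(W) = ‖W_{L:1} − √λY‖² + λ∑‖W_l‖²` whose members have all layers bounded in spectral
norm by `σ*_max`, for all `W` with `dist(W,S) ≤ σ*_max` one has
`‖∇G(W)‖_F ≤ L_G·dist(W,S)` where
`L_G = λL + 2^{2L−1}L²σ*_max^{2L−2} + √λ·‖Y‖·2^{L−2}L²σ*_max^{L−2}`. -/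
theorem stmt19 (L : ℕ) (hL : 2 ≤ L) (d : ℕ → ℕ) (lam : ℝ) (hlam : 0 < lam)
    (Y : Matrix (Fin (d L)) (Fin (d 0)) ℝ) (σmax : ℝ) (hσ : 0 < σmax)
    (S : Set (∀ l : ℕ, Matrix (Fin (d (l + 1))) (Fin (d l)) ℝ)) (hS : S.Nonempty)
    (hScrit : ∀ V ∈ S, ∀ (j : ℕ) (hj : j < L),
      gradReg d L V (fun _ => lam) (Real.sqrt lam) Y j hj = 0)
    (hSbd : ∀ V ∈ S, ∀ l < L, spec (V l) ≤ σmax) :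
    ∀ W, tdist d L W S ≤ σmax →
      gradNorm d L W (fun _ => lam) (Real.sqrt lam) Y
        ≤ (lam * (L : ℝ) + 2 ^ (2 * L - 1) * (L : ℝ) ^ 2 * σmax ^ (2 * L - 2)
            + Real.sqrt lam * spec Y * 2 ^ (L - 2) * (L : ℝ) ^ 2 * σmax ^ (L - 2))
          * tdist d L W S := by
  intro W hW
  set t := tdist d L W S with ht
  set R := {r : ℝ | ∃ V ∈ S, r = Real.sqrt (∑ j : Fin L, (frob (W j - V j)) ^ 2)} with hR
  have hne : R.Nonempty := by
    obtain ⟨V, hV⟩ := hS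
    exact ⟨_, V, hV, rfl⟩
  have ht0 : 0 ≤ t := by
    apply Real.sInf_nonneg
    rintro r ⟨V, _, rfl⟩
    exact Real.sqrt_nonneg _
  let F : ℝ → ℝ := fun D => ((4 * (σmax + D) ^ (2 * L - 2)
      + 2 * (Real.sqrt lam * spec Y) * (σmax + D) ^ (L - 2)) * L + 2 * lam) * D
  have hF : Continuous F := by fun_prop
  have h1 : ∀ D > t, gradNorm d L W (fun _ => lam) (Real.sqrt lam) Y ≤ F D := by
    intro D hD
    obtain ⟨r, ⟨V, hV, rfl⟩, hr⟩ := exists_lt_of_csInf_lt hne hD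
    exact grad_near L hL d lam hlam Y σmax hσ W V (hScrit V hV) (hSbd V hV) D hr.le
  have h2 : gradNorm d L W (fun _ => lam) (Real.sqrt lam) Y ≤ F t :=
    ge_of_tendsto ((hF.tendsto t).mono_left nhdsWithin_le_nhds)
      (Filter.eventually_of_mem (self_mem_nhdsWithin : Set.Ioi t ∈ nhdsWithin t (Set.Ioi t)) h1)
  refine h2.trans (mul_le_mul_of_nonneg_right ?_ ht0)
  have hy := mul_nonneg (Real.sqrt_nonneg lam) (spec_nonneg Y)
  have hL' : (2 : ℝ) ≤ L := by exact_mod_cast hL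
  have p1 : (σmax + t) ^ (2 * L - 2) ≤ 2 ^ (2 * L - 2) * σmax ^ (2 * L - 2) := by
    rw [← mul_pow]; exact pow_le_pow_left₀ (by positivity) (by linarith) _
  have p2 : (σmax + t) ^ (L - 2) ≤ 2 ^ (L - 2) * σmax ^ (L - 2) := by
    rw [← mul_pow]; exact pow_le_pow_left₀ (by positivity) (by linarith) _
  have e : (2 : ℝ) ^ (2 * L - 1) = 2 * 2 ^ (2 * L - 2) := by
    rw [← pow_succ']; congr 1; omega
  rw [e]
  set a := (2 : ℝ) ^ (2 * L - 2) * σmax ^ (2 * L - 2) with ha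
  set b := (2 : ℝ) ^ (L - 2) * σmax ^ (L - 2) with hb
  have ha0 : 0 ≤ a := by positivity
  have hb0 : 0 ≤ b := by positivity
  have hLL : 2 * (L : ℝ) ≤ (L : ℝ) ^ 2 := by nlinarith
  calc (4 * (σmax + t) ^ (2 * L - 2)
      + 2 * (Real.sqrt lam * spec Y) * (σmax + t) ^ (L - 2)) * L + 2 * lam
      ≤ (4 * a + 2 * (Real.sqrt lam * spec Y) * b) * L + 2 * lam := by gcongr
    _ = (2 * a + (Real.sqrt lam * spec Y) * b) * (2 * L) + lam * 2 := by ring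
    _ ≤ (2 * a + (Real.sqrt lam * spec Y) * b) * (L : ℝ) ^ 2 + lam * L := by gcongr
    _ = _ := by rw [ha, hb]; ring
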